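/- For every integer n ≥ 1, every α > 0 and every t > 0, the recurrence coefficient β_n(t) satisfies β_n(t) = n(n + α) + t H_n'(t) − H_n(t). -/

import Mathlib

open MeasureTheory Set

/-- The singularly perturbed Laguerre weight `w(x; t, α) = x^α e^{-x - t/x}`. -/
noncomputable def pertLagWeight (α t x : ℝ) : ℝ := x ^ α * Real.exp (-x - t / x)

/-- The `j`-th moment `μ_j(t) = ∫_0^∞ x^j w(x; t, α) dx`. -/
noncomputable def pertLagMoment (α t : ℝ) (j : ℕ) : ℝ :=
  ∫ x in Set.Ioi (0:ℝ), x ^ j * pertLagWeight α t x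

/-- The Hankel determinant `D_n[w; t] = det(μ_{j+k}(t))_{j,k=0}^{n-1}`. -/
noncomputable def hankelDet (α : ℝ) (n : ℕ) (t : ℝ) : ℝ :=
  (Matrix.of (fun j k : Fin n => pertLagMoment α t (j.1 + k.1))).det

/-- `H_n(t) = t (d/dt) ln D_n[w; t]`. -/
noncomputable def Hlog (α : ℝ) (n : ℕ) (t : ℝ) : ℝ :=
  t * deriv (fun τ => Real.log (hankelDet α n τ)) t

section MatrixCalculus

open Matrix Filter Topology

variable {ι : Type*} [Fintype ι]

theorem hasDerivAt_matrix_mul_apply {A B : ℝ → Matrix ι ι ℝ} {A' B' : Matrix ι ι ℝ} {s : ℝ}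
    (hA : ∀ i j, HasDerivAt (fun r => A r i j) (A' i j) s)
    (hB : ∀ i j, HasDerivAt (fun r => B r i j) (B' i j) s) (i j : ι) :
    HasDerivAt (fun r => (A r * B r) i j) ((A' * B s + A s * B') i j) s := by
  simp only [Matrix.mul_apply, Matrix.add_apply, ← Finset.sum_add_distrib]
  exact HasDerivAt.fun_sum fun k _ => (hA i k).mul (hB k j)

variable [DecidableEq ι]

theorem hasDerivAt_matrix_det {M : ℝ → Matrix ι ι ℝ} {M' : Matrix ι ι ℝ} {s : ℝ}
    (hM : ∀ i j, HasDerivAt (fun r => M r i j) (M' i j) s) :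
    HasDerivAt (fun r => (M r).det) ((M s).adjugate * M').trace s := by
  have htrace : ((M s).adjugate * M').trace =
      ∑ σ : Equiv.Perm ι, ((Equiv.Perm.sign σ : ℤ) : ℝ) *
        ∑ i, (∏ j ∈ Finset.univ.erase i, M s (σ j) j) • M' (σ i) i := by
    have h1 : ((M s).adjugate * M').trace =
        ∑ i, ((M s).updateCol i (fun k => M' k i)).det := by
      refine Finset.sum_congr rfl fun i _ => ?_
      rw [← Matrix.cramer_apply, Matrix.cramer_eq_adjugate_mulVec]
      rfl
    rw [h1]
    simp only [Matrix.det_apply', Finset.mul_sum]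
    rw [Finset.sum_comm]
    refine Finset.sum_congr rfl fun σ _ => Finset.sum_congr rfl fun i _ => ?_
    rw [← Finset.mul_prod_erase _ _ (Finset.mem_univ i), Matrix.updateCol_self, smul_eq_mul,
      mul_comm (M' (σ i) i)]
    congr 2
    exact Finset.prod_congr rfl fun j hj => Matrix.updateCol_ne (Finset.ne_of_mem_erase hj)
  rw [htrace]
  simp only [Matrix.det_apply']
  exact HasDerivAt.fun_sum fun σ _ =>
    (HasDerivAt.fun_finsetProd fun i _ => hM (σ i) i).const_mul _

theorem hasDerivAt_log_det {M : ℝ → Matrix ι ι ℝ} {M' : Matrix ι ι ℝ} {s : ℝ}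
    (hM : ∀ i j, HasDerivAt (fun r => M r i j) (M' i j) s) (hdet : (M s).det ≠ 0) :
    HasDerivAt (fun r => Real.log (M r).det) ((M s)⁻¹ * M').trace s := by
  convert (hasDerivAt_matrix_det hM).log hdet using 1
  rw [Matrix.inv_def, Matrix.smul_mul, Matrix.trace_smul, Ring.inverse_eq_inv', smul_eq_mul,
    div_eq_inv_mul]

theorem hasDerivAt_matrix_inv_apply {M : ℝ → Matrix ι ι ℝ} {M' : Matrix ι ι ℝ} {s : ℝ}
    (hM : ∀ i j, HasDerivAt (fun r => M r i j) (M' i j) s) (hdet : (M s).det ≠ 0) (i j : ι) :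
    HasDerivAt (fun r => (M r)⁻¹ i j) ((-((M s)⁻¹ * M' * (M s)⁻¹)) i j) s := by
  have hdiff : ∀ i j, DifferentiableAt ℝ (fun r => (M r)⁻¹ i j) s := by
    intro i j
    simp only [Matrix.inv_def, Matrix.smul_apply, Ring.inverse_eq_inv', smul_eq_mul,
      Matrix.adjugate_apply]
    refine ((hasDerivAt_matrix_det hM).differentiableAt.inv hdet).mul ?_
    refine (hasDerivAt_matrix_det (M' := M'.updateRow j 0) fun k l => ?_).differentiableAt
    by_cases hk : k = j
    · subst hk
      simpa using hasDerivAt_const s _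
    · simpa [Matrix.updateRow_ne hk] using hM k l
  set R : Matrix ι ι ℝ := Matrix.of fun i j => deriv (fun r => (M r)⁻¹ i j) s with hR
  have hRd : ∀ i j, HasDerivAt (fun r => (M r)⁻¹ i j) (R i j) s := fun i j =>
    (hdiff i j).hasDerivAt
  have hev : ∀ᶠ r in 𝓝 s, (M r).det ≠ 0 :=
    (hasDerivAt_matrix_det hM).continuousAt.eventually_ne hdet
  have hzero : R * M s + (M s)⁻¹ * M' = 0 := by
    ext k l
    refine (hasDerivAt_matrix_mul_apply hRd hM k l).unique ?_
    refine (hasDerivAt_const s ((1 : Matrix ι ι ℝ) k l)).congr_of_eventuallyEq ?_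
    filter_upwards [hev] with r hr
    rw [Matrix.nonsing_inv_mul _ (isUnit_iff_ne_zero.mpr hr)]
  have hRval : R = -((M s)⁻¹ * M' * (M s)⁻¹) := by
    have := congrArg (· * (M s)⁻¹) hzero
    simp only [add_mul, zero_mul, Matrix.mul_assoc R,
      Matrix.mul_nonsing_inv _ (isUnit_iff_ne_zero.mpr hdet), mul_one] at this
    exact eq_neg_of_add_eq_zero_left this
  exact hRval ▸ hRd i j

theorem hasDerivAt_trace_inv_mul {M M₁ : ℝ → Matrix ι ι ℝ} {M₂ : Matrix ι ι ℝ} {s : ℝ}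
    (hM : ∀ i j, HasDerivAt (fun r => M r i j) (M₁ s i j) s)
    (hM₁ : ∀ i j, HasDerivAt (fun r => M₁ r i j) (M₂ i j) s) (hdet : (M s).det ≠ 0) :
    HasDerivAt (fun r => ((M r)⁻¹ * M₁ r).trace)
      (((M s)⁻¹ * M₂).trace - ((M s)⁻¹ * M₁ s * ((M s)⁻¹ * M₁ s)).trace) s := by
  have key : ((M s)⁻¹ * M₂).trace - ((M s)⁻¹ * M₁ s * ((M s)⁻¹ * M₁ s)).trace =
      ∑ i, (-((M s)⁻¹ * M₁ s * (M s)⁻¹) * M₁ s + (M s)⁻¹ * M₂) i i := by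
    change _ = (-((M s)⁻¹ * M₁ s * (M s)⁻¹) * M₁ s + (M s)⁻¹ * M₂).trace
    rw [Matrix.trace_add, Matrix.neg_mul, Matrix.trace_neg, ← Matrix.mul_assoc]
    ring
  rw [key]
  exact HasDerivAt.fun_sum fun i _ =>
    hasDerivAt_matrix_mul_apply (hasDerivAt_matrix_inv_apply hM hdet) hM₁ i i

end MatrixCalculus

section OrthogonalPolynomials

open Matrix Filter Topology Polynomial

/-- The linear functional on polynomials with prescribed moments. -/
noncomputable def momentFunctional (m : ℕ → ℝ) : ℝ[X] →ₗ[ℝ] ℝ :=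
  Polynomial.lsum fun k => m k • LinearMap.id

theorem momentFunctional_apply (m : ℕ → ℝ) (q : ℝ[X]) :
    momentFunctional m q = ∑ k ∈ Finset.range (q.natDegree + 1), m k * q.coeff k := by
  change q.sum (fun k a => m k * a) = _
  exact Polynomial.sum_over_range _ fun k => mul_zero _

theorem momentFunctional_monomial (m : ℕ → ℝ) (k : ℕ) (a : ℝ) :
    momentFunctional m (monomial k a) = m k * a := by
  change (monomial k a).sum (fun k a => m k * a) = _
  exact Polynomial.sum_monomial_index _ _ (mul_zero _)

theorem hasDerivAt_momentFunctional {m : ℕ → ℝ → ℝ} {s : ℝ}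
    (hm : ∀ k, HasDerivAt (m k) (-m (k + 1) s) s) (q : ℝ[X]) :
    HasDerivAt (fun r => momentFunctional (m · r) q) (-momentFunctional (m · s) (X * q)) s := by
  induction q using Polynomial.induction_on' with
  | add p q hp hq => simpa only [mul_add, map_add, neg_add] using hp.fun_add hq
  | monomial k a =>
    simp only [X_mul_monomial, momentFunctional_monomial, ← neg_mul]
    exact (hm k).mul_const a

variable {L : ℝ[X] →ₗ[ℝ] ℝ} {p : ℕ → ℝ[X]} {h : ℕ → ℝ}

theorem coeff_self_of_monic (hp : ∀ j, (p j).Monic) (hd : ∀ j, (p j).natDegree = j) (n : ℕ) :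
    (p n).coeff n = 1 := by
  simpa only [Monic, leadingCoeff, hd] using hp n

theorem degree_X_mul_lt_of_monic (hp : ∀ j, (p j).Monic) (hd : ∀ j, (p j).natDegree = j)
    {i n : ℕ} (hi : i + 1 < n) : (X * p i).degree < (n : WithBot ℕ) := by
  rw [degree_mul, degree_X, degree_eq_natDegree (hp i).ne_zero, hd, add_comm]
  exact_mod_cast hi

theorem exists_eq_sum_of_monic (hp : ∀ j, (p j).Monic) (hd : ∀ j, (p j).natDegree = j) (n : ℕ) :
    ∀ q : ℝ[X], q.degree < n → ∃ c : ℕ → ℝ, q = ∑ k ∈ Finset.range n, c k • p k := by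
  induction n with
  | zero =>
    intro q hq
    exact ⟨0, by simpa using hq⟩
  | succ n ih =>
    intro q hq
    have hlt : (q - q.coeff n • p n).degree < n := by
      rw [Polynomial.degree_lt_iff_coeff_zero] at hq ⊢
      intro k hk
      rcases hk.eq_or_lt with rfl | hk
      · simp [coeff_self_of_monic hp hd]
      · have : (p n).coeff k = 0 := coeff_eq_zero_of_natDegree_lt (by rwa [hd])
        simp [this, hq k hk]
    obtain ⟨c, hc⟩ := ih _ hlt
    refine ⟨Function.update c n (q.coeff n), ?_⟩
    rw [Finset.sum_range_succ, Function.update_self]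
    rw [Finset.sum_congr rfl fun k hk => by
      rw [Function.update_of_ne (Finset.mem_range.mp hk).ne], ← hc]
    abel

theorem map_mul_orthogonal_of_degree_lt (hp : ∀ j, (p j).Monic) (hd : ∀ j, (p j).natDegree = j)
    (ho : ∀ j k, L (p j * p k) = if j = k then h j else 0) {n : ℕ} {q : ℝ[X]}
    (hq : q.degree < (n + 1 : ℕ)) : L (q * p n) = q.coeff n * h n := by
  obtain ⟨c, rfl⟩ := exists_eq_sum_of_monic hp hd (n + 1) q hq
  have hcoeff : (∑ k ∈ Finset.range (n + 1), c k • p k).coeff n = c n := by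
    rw [Finset.sum_range_succ, coeff_add, finsetSum_coeff, Finset.sum_eq_zero, zero_add]
    · simp [coeff_self_of_monic hp hd]
    · intro k hk
      rw [coeff_smul, coeff_eq_zero_of_natDegree_lt (by simpa [hd] using hk), smul_zero]
  rw [hcoeff]
  simp [Finset.sum_mul, ho]

theorem parseval_of_degree_lt (hp : ∀ j, (p j).Monic) (hd : ∀ j, (p j).natDegree = j)
    (ho : ∀ j k, L (p j * p k) = if j = k then h j else 0) (hpos : ∀ j, 0 < h j) {n : ℕ}
    {q : ℝ[X]} (hq : q.degree < n) :
    L (q * q) = ∑ k ∈ Finset.range n, L (q * p k) ^ 2 / h k := by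
  obtain ⟨c, hc⟩ := exists_eq_sum_of_monic hp hd n q hq
  have hk : ∀ k ∈ Finset.range n, L (q * p k) = c k * h k := by
    intro k hk
    rw [hc]
    simp only [Finset.sum_mul, smul_mul_assoc, map_sum, map_smul, ho, smul_eq_mul, mul_ite,
      mul_zero]
    rw [Finset.sum_ite_eq' (Finset.range n) k, if_pos hk]
  have hqq : L (q * q) = ∑ k ∈ Finset.range n, c k * L (q * p k) := by
    conv_lhs => rw [hc, Finset.mul_sum, ← hc]
    simp
  rw [hqq]
  refine Finset.sum_congr rfl fun k hkn => ?_
  have := (hpos k).ne'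
  rw [hk k hkn]
  field_simp

theorem det_gram_eq_det_hankel (hp : ∀ j, (p j).Monic) (hd : ∀ j, (p j).natDegree = j)
    (m : ℕ → ℝ) (n : ℕ) :
    (Matrix.of fun i j : Fin n => momentFunctional m (p i * p j)).det =
      (Matrix.of fun i j : Fin n => m (i + j)).det := by
  set C : Matrix (Fin n) (Fin n) ℝ := Matrix.of fun i j => (p j).coeff i with hC
  have hdet : C.det = 1 :=
    Matrix.det_matrixOfPolynomials _ (fun i => hd i) fun i => hp i
  have hexp : ∀ j : Fin n, p j = ∑ k : Fin n, monomial k ((p j).coeff k) := by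
    intro j
    rw [Fin.sum_univ_eq_sum_range (fun k => monomial k ((p j).coeff k)) n]
    exact Polynomial.as_sum_range' _ _ (by rw [hd]; exact j.2)
  have hmul : (Matrix.of fun i j : Fin n => momentFunctional m (p i * p j)) =
      Cᵀ * (Matrix.of fun i j : Fin n => m (i + j)) * C := by
    ext i j
    rw [Matrix.of_apply, hexp i, hexp j, Finset.sum_mul_sum]
    simp only [map_sum, monomial_mul_monomial, momentFunctional_monomial,
      Matrix.mul_apply, hC, Matrix.of_apply, Matrix.transpose_apply, Finset.sum_mul]
    rw [Finset.sum_comm]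
    exact Finset.sum_congr rfl fun _ _ => Finset.sum_congr rfl fun _ _ => by ring
  rw [hmul, Matrix.det_mul, Matrix.det_mul, Matrix.det_transpose, hdet, one_mul, mul_one]

/-- The Toda identity for the traces appearing in the second logarithmic derivative of the
Gram determinant. -/
theorem trace_gram_toda (hp : ∀ j, (p j).Monic) (hd : ∀ j, (p j).natDegree = j)
    (ho : ∀ j k, L (p j * p k) = if j = k then h j else 0) (hpos : ∀ j, 0 < h j) (d : ℕ)
    {N N₁ N₂ : Matrix (Fin (d + 1)) (Fin (d + 1)) ℝ} (hN : ∀ i j, N i j = L (p i * p j))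
    (hN₁ : ∀ i j, N₁ i j = -L (X * (p i * p j))) (hN₂ : ∀ i j, N₂ i j = L (X * (X * (p i * p j)))) :
    (N⁻¹ * N₂).trace - (N⁻¹ * N₁ * (N⁻¹ * N₁)).trace = h (d + 1) / h d := by
  have hNd : N = Matrix.diagonal fun i : Fin (d + 1) => h i := by
    ext i j
    simp [hN, ho, Matrix.diagonal_apply, Fin.ext_iff]
  have hNi : N⁻¹ = Matrix.diagonal fun i : Fin (d + 1) => (h i)⁻¹ := by
    refine Matrix.inv_eq_left_inv ?_
    rw [hNd, Matrix.diagonal_mul_diagonal]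
    simp [(hpos _).ne']
  have hdeg : ∀ i : ℕ, i < d + 1 → (X * p i).degree < ((d + 1 + 1 : ℕ) : WithBot ℕ) :=
    fun i hi => degree_X_mul_lt_of_monic hp hd (by omega)
  have hsecond : ∀ i : Fin (d + 1), N₂ i i = (∑ k : Fin (d + 1), N₁ i k ^ 2 / h k) +
      if (i : ℕ) = d then h (d + 1) else 0 := by
    intro i
    have e : X * (X * (p i * p i)) = (X * p i) * (X * p i) := by ring
    rw [hN₂, e, parseval_of_degree_lt hp hd ho hpos (hdeg i i.2), Finset.sum_range_succ,
      ← Fin.sum_univ_eq_sum_range (fun k => L (X * p i * p k) ^ 2 / h k)]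
    congr 1
    · exact Finset.sum_congr rfl fun k _ => by rw [hN₁, neg_sq, mul_assoc]
    · rw [map_mul_orthogonal_of_degree_lt hp hd ho (hdeg i i.2), coeff_X_mul]
      have := (hpos (d + 1)).ne'
      split_ifs with hi
      · rw [hi, coeff_self_of_monic hp hd]
        field_simp
      · rw [coeff_eq_zero_of_natDegree_lt (by rw [hd]; omega)]
        simp
  have hsymm : ∀ i k, N₁ i k = N₁ k i := fun i k => by
    rw [hN₁, hN₁, mul_comm (p i)]
  have htr₁ : (N⁻¹ * N₁ * (N⁻¹ * N₁)).trace =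
      ∑ i : Fin (d + 1), (h i)⁻¹ * ∑ k : Fin (d + 1), N₁ i k ^ 2 / h k := by
    refine Finset.sum_congr rfl fun i _ => ?_
    simp only [hNi, Matrix.diag_apply, Matrix.mul_apply (M := _ * N₁), Matrix.diagonal_mul]
    rw [Finset.mul_sum]
    refine Finset.sum_congr rfl fun k _ => ?_
    rw [hsymm k i]
    ring
  have htr₂ : (N⁻¹ * N₂).trace = ∑ i : Fin (d + 1), (h i)⁻¹ * N₂ i i :=
    Finset.sum_congr rfl fun i _ => by rw [hNi, Matrix.diag_apply, Matrix.diagonal_mul]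
  rw [htr₁, htr₂, ← Finset.sum_sub_distrib]
  simp only [hsecond, mul_add, add_sub_cancel_left]
  rw [Fin.sum_univ_eq_sum_range (fun k => (h k)⁻¹ * if k = d then h (d + 1) else 0),
    Finset.sum_eq_single d]
  · rw [if_pos rfl, div_eq_inv_mul]
  · intro k _ hk
    rw [if_neg hk, mul_zero]
  · simp

/-- The Toda equation: the second logarithmic derivative of a Hankel determinant whose moments
satisfy `m_k' = -m_{k+1}` is a ratio of consecutive squared norms. -/
theorem hankel_toda {m : ℕ → ℝ → ℝ} {s₀ : ℝ}
    (hm : ∀ᶠ s in 𝓝 s₀, ∀ k, HasDerivAt (m k) (-m (k + 1) s) s)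
    (hp : ∀ j, (p j).Monic) (hd : ∀ j, (p j).natDegree = j)
    (ho : ∀ j k, momentFunctional (m · s₀) (p j * p k) = if j = k then h j else 0)
    (hpos : ∀ j, 0 < h j) (d : ℕ) :
    ∃ g : ℝ → ℝ,
      (∀ᶠ s in 𝓝 s₀, (Matrix.of fun i j : Fin (d + 1) => m (i + j) s).det ≠ 0 ∧ HasDerivAt
        (fun r => Real.log (Matrix.of fun i j : Fin (d + 1) => m (i + j) r).det) (g s) s) ∧
      HasDerivAt g (h (d + 1) / h d) s₀ := by
  set N : ℝ → Matrix (Fin (d + 1)) (Fin (d + 1)) ℝ :=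
    fun s => Matrix.of fun i j => momentFunctional (m · s) (p i * p j) with hN
  set N₁ : ℝ → Matrix (Fin (d + 1)) (Fin (d + 1)) ℝ :=
    fun s => Matrix.of fun i j => -momentFunctional (m · s) (X * (p i * p j)) with hN₁
  set N₂ : Matrix (Fin (d + 1)) (Fin (d + 1)) ℝ :=
    Matrix.of fun i j => momentFunctional (m · s₀) (X * (X * (p i * p j))) with hN₂
  have hdetN : ∀ s, (Matrix.of fun i j : Fin (d + 1) => m (i + j) s).det = (N s).det := fun s =>
    (det_gram_eq_det_hankel hp hd (m · s) (d + 1)).symm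
  have hNder : ∀ᶠ s in 𝓝 s₀, ∀ i j, HasDerivAt (fun r => N r i j) (N₁ s i j) s :=
    hm.mono fun s hs i j => hasDerivAt_momentFunctional hs _
  have hN₁der : ∀ i j, HasDerivAt (fun r => N₁ r i j) (N₂ i j) s₀ := fun i j => by
    simpa only [neg_neg] using! (hasDerivAt_momentFunctional hm.self_of_nhds _).neg
  have hdet : (N s₀).det ≠ 0 := by
    have hNd : N s₀ = Matrix.diagonal fun i : Fin (d + 1) => h i := by
      ext i j
      simp [hN, ho, Matrix.diagonal_apply, Fin.ext_iff]
    rw [hNd, Matrix.det_diagonal]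
    exact (Finset.prod_pos fun (i : Fin (d + 1)) _ => hpos i).ne'
  have hev : ∀ᶠ s in 𝓝 s₀, (N s).det ≠ 0 :=
    (hasDerivAt_matrix_det hNder.self_of_nhds).continuousAt.eventually_ne hdet
  simp only [hdetN]
  refine ⟨fun s => ((N s)⁻¹ * N₁ s).trace, ?_, ?_⟩
  · filter_upwards [hNder, hev] with s hs hs' using ⟨hs', hasDerivAt_log_det hs hs'⟩
  · rw [← trace_gram_toda hp hd ho hpos d (N := N s₀) (N₁ := N₁ s₀) (N₂ := N₂)
      (fun _ _ => rfl) (fun _ _ => rfl) (fun _ _ => rfl)]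
    exact hasDerivAt_trace_inv_mul hNder.self_of_nhds hN₁der hdet

end OrthogonalPolynomials

section PerturbedLaguerre

open Filter Topology

/-- The moments of the weight `x^α e^{-s x - t/x}`, where the exponential rate `s` is the Toda
time. -/
noncomputable def todaMoment (α t : ℝ) (k : ℕ) (s : ℝ) : ℝ :=
  ∫ x in Ioi (0 : ℝ), x ^ k * (x ^ α * Real.exp (-s * x - t / x))

theorem continuousOn_todaMoment_integrand (α t : ℝ) (k : ℕ) (s : ℝ) :
    ContinuousOn (fun x : ℝ => x ^ k * (x ^ α * Real.exp (-s * x - t / x))) (Ioi 0) := by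
  intro x hx
  have hx' : x ≠ 0 := (mem_Ioi.mp hx).ne'
  have := Real.continuousAt_rpow_const x α (Or.inl hx')
  exact ContinuousAt.continuousWithinAt (by fun_prop (disch := assumption))

theorem integrableOn_todaMoment_integrand {α t s : ℝ} (hα : 0 < α) (ht : 0 < t) (hs : 0 < s)
    (k : ℕ) :
    IntegrableOn (fun x : ℝ => x ^ k * (x ^ α * Real.exp (-s * x - t / x))) (Ioi 0) := by
  have hk : (-1 : ℝ) < k + α := by linarith [k.cast_nonneg (α := ℝ)]
  refine (integrableOn_rpow_mul_exp_neg_mul_rpow hk one_pos hs).mono'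
    ((continuousOn_todaMoment_integrand α t k s).aestronglyMeasurable measurableSet_Ioi) ?_
  refine (ae_restrict_iff' measurableSet_Ioi).mpr (Eventually.of_forall fun x hx => ?_)
  have hx : 0 < x := hx
  rw [Real.norm_of_nonneg (by positivity), Real.rpow_add hx, Real.rpow_natCast, Real.rpow_one,
    mul_assoc]
  gcongr
  have : 0 < t / x := by positivity
  linarith

theorem hasDerivAt_todaMoment {α t s : ℝ} (hα : 0 < α) (ht : 0 < t) (hs : 0 < s) (k : ℕ) :
    HasDerivAt (todaMoment α t k) (-todaMoment α t (k + 1) s) s := by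
  have hint := integrableOn_todaMoment_integrand (s := s / 2) hα ht (by positivity) (k + 1)
  have key := hasDerivAt_integral_of_dominated_loc_of_deriv_le
    (μ := volume.restrict (Ioi (0 : ℝ)))
    (F := fun r x => x ^ k * (x ^ α * Real.exp (-r * x - t / x)))
    (F' := fun r x => -(x ^ (k + 1) * (x ^ α * Real.exp (-r * x - t / x))))
    (Ioi_mem_nhds (half_lt_self hs))
    (Eventually.of_forall fun r =>
      (continuousOn_todaMoment_integrand α t k r).aestronglyMeasurable measurableSet_Ioi)
    (integrableOn_todaMoment_integrand hα ht hs k)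
    ((continuousOn_todaMoment_integrand α t (k + 1) s).neg.aestronglyMeasurable
      measurableSet_Ioi)
    ((ae_restrict_iff' measurableSet_Ioi).mpr (Eventually.of_forall fun x hx r hr => by
      have hx : 0 < x := hx
      have hr : s / 2 < r := hr
      rw [norm_neg, Real.norm_of_nonneg (by positivity)]
      gcongr)) hint
    (Eventually.of_forall fun x r _ => by
      refine (((((hasDerivAt_id r).neg.mul_const x).sub_const (t / x)).exp.const_mul
        (x ^ α)).const_mul (x ^ k)).congr_deriv ?_
      simp only [Pi.neg_apply, id]
      ring)
  have h2 := key.2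
  rw [integral_neg] at h2
  exact h2

theorem pertLagMoment_eq_todaMoment (α t : ℝ) (k : ℕ) :
    pertLagMoment α t k = todaMoment α t k 1 := by
  simp [pertLagMoment, todaMoment, pertLagWeight]

theorem pertLagMoment_mul {s : ℝ} (hs : 0 < s) (α t : ℝ) (k : ℕ) :
    pertLagMoment α (s * t) k = s ^ (k + α + 1) * todaMoment α t k s := by
  have h := integral_comp_mul_left_Ioi'
    (fun x => x ^ k * pertLagWeight α (s * t) x) 0 hs
  rw [mul_zero] at h
  rw [pertLagMoment, ← h, todaMoment, Real.rpow_add hs, Real.rpow_add hs, Real.rpow_natCast,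
    Real.rpow_one, smul_eq_mul, mul_comm _ s, mul_assoc, ← integral_const_mul,
    ← integral_const_mul, ← integral_const_mul]
  refine setIntegral_congr_fun measurableSet_Ioi fun x hx => ?_
  have hx : 0 < x := hx
  simp only [pertLagWeight]
  rw [Real.mul_rpow hs.le hx.le, mul_div_mul_left _ _ hs.ne', mul_pow, neg_mul]
  ring

theorem hankelDet_mul {s : ℝ} (hs : 0 < s) (α t : ℝ) (n : ℕ) :
    hankelDet α n (s * t) = s ^ ((n : ℝ) * (n + α)) *
      (Matrix.of fun i j : Fin n => todaMoment α t (i + j) s).det := by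
  have hprod : ∀ n : ℕ, (∏ i ∈ Finset.range n, s ^ (i : ℝ)) *
      ∏ i ∈ Finset.range n, s ^ (i + α + 1) = s ^ ((n : ℝ) * (n + α)) := by
    intro n
    rw [← Finset.prod_mul_distrib]
    induction n with
    | zero => simp
    | succ n ih =>
      rw [Finset.prod_range_succ, ih, ← Real.rpow_add hs, ← Real.rpow_add hs]
      congr 1
      push_cast
      ring
  rw [← hprod, ← Fin.prod_univ_eq_prod_range (fun i => s ^ (i : ℝ)),
    ← Fin.prod_univ_eq_prod_range (fun i => s ^ ((i : ℝ) + α + 1)), mul_assoc,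
    ← Matrix.det_mul_row, ← Matrix.det_mul_column, hankelDet]
  congr 1
  ext i j
  simp only [Matrix.of_apply]
  rw [pertLagMoment_mul hs, ← mul_assoc, ← Real.rpow_add hs]
  congr 2
  push_cast
  ring

theorem integral_eval_mul_pertLagWeight {α t : ℝ} (hα : 0 < α) (ht : 0 < t)
    (q : Polynomial ℝ) :
    ∫ x in Ioi (0 : ℝ), q.eval x * pertLagWeight α t x =
      momentFunctional (todaMoment α t · 1) q := by
  rw [momentFunctional_apply]
  simp only [Polynomial.eval_eq_sum_range, Finset.sum_mul]
  have hint : ∀ k, IntegrableOn (fun x : ℝ => x ^ k * pertLagWeight α t x) (Ioi 0) := fun k => by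
    simpa [pertLagWeight] using integrableOn_todaMoment_integrand hα ht one_pos k
  simp only [mul_assoc]
  rw [integral_finsetSum _ fun k _ => (hint k).const_mul _]
  refine Finset.sum_congr rfl fun k _ => ?_
  rw [integral_const_mul, ← pertLagMoment_eq_todaMoment, mul_comm]
  rfl

/-- The scaling relation between `Hlog` and the Toda time derivative of the Hankel determinant. -/
theorem mul_deriv_Hlog_sub_Hlog {α t b : ℝ} (ht : 0 < t) {n : ℕ} {g : ℝ → ℝ}
    (hg : ∀ᶠ s in 𝓝 (1 : ℝ),
      (Matrix.of fun i j : Fin n => todaMoment α t (i + j) s).det ≠ 0 ∧ HasDerivAt (fun r =>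
        Real.log (Matrix.of fun i j : Fin n => todaMoment α t (i + j) r).det) (g s) s)
    (hg' : HasDerivAt g b 1) :
    t * deriv (Hlog α n) t - Hlog α n t = b - n * (n + α) := by
  have hdiv : Tendsto (fun τ : ℝ => τ / t) (𝓝 t) (𝓝 1) := by
    have : ContinuousAt (fun τ : ℝ => τ / t) t := by fun_prop
    simpa [ContinuousAt, div_self ht.ne'] using this
  have hdivder : ∀ τ : ℝ, HasDerivAt (fun τ : ℝ => τ / t) (1 / t) τ := fun τ =>
    (hasDerivAt_id τ).div_const t
  have hlog : ∀ᶠ τ in 𝓝 t, Real.log (hankelDet α n τ) = n * (n + α) * Real.log (τ / t) +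
      Real.log (Matrix.of fun i j : Fin n => todaMoment α t (i + j) (τ / t)).det := by
    filter_upwards [hdiv.eventually hg, lt_mem_nhds ht] with τ h1 hτ
    have hs : 0 < τ / t := by positivity
    have := hankelDet_mul hs α t n
    rw [div_mul_cancel₀ _ ht.ne'] at this
    rw [this, Real.log_mul (Real.rpow_pos_of_pos hs _).ne' h1.1, Real.log_rpow hs]
  have hH : Hlog α n =ᶠ[𝓝 t] fun τ => n * (n + α) + τ / t * g (τ / t) := by
    filter_upwards [hlog.eventually_nhds, hdiv.eventually hg, lt_mem_nhds ht] with τ h1 h2 hτ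
    have hs : 0 < τ / t := by positivity
    have hder := (((hdivder τ).log hs.ne').const_mul ((n : ℝ) * (n + α))).add
      (h2.2.comp τ (hdivder τ))
    rw [Hlog, (hder.congr_of_eventuallyEq h1).deriv]
    field_simp
  have hHder : HasDerivAt (fun τ => n * (n + α) + τ / t * g (τ / t))
      (1 / t * g (t / t) + t / t * (b * (1 / t))) t := by
    refine ((hdivder t).mul (HasDerivAt.comp t ?_ (hdivder t))).const_add _
    rwa [div_self ht.ne']
  rw [hH.deriv_eq, hHder.deriv, hH.eq_of_nhds, div_self ht.ne']
  field_simp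
  ring

end PerturbedLaguerre

/-- For every integer `n ≥ 1`, `α > 0`, `t > 0`, the recurrence coefficient
`β_n(t)` satisfies `β_n(t) = n(n+α) + t H_n'(t) - H_n(t)`. -/
theorem beta_n_eq_via_H
    (α : ℝ) (hα : 0 < α) (t : ℝ) (ht : 0 < t) (n : ℕ) (hn : 1 ≤ n)
    (P : ℕ → ℝ → ℝ → ℝ) (h : ℕ → ℝ → ℝ) (A B : ℕ → ℝ → ℝ)
    (hmonic : ∀ m : ℕ, ∀ τ > (0:ℝ), ∃ p : Polynomial ℝ,
      p.Monic ∧ p.natDegree = m ∧ ∀ x, P m τ x = p.eval x)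
    (horth : ∀ j k : ℕ, ∀ τ > (0:ℝ),
      (∫ x in Ioi (0:ℝ), P j τ x * P k τ x * pertLagWeight α τ x)
        = if j = k then h j τ else 0)
    (hpos : ∀ j : ℕ, ∀ τ > (0:ℝ), 0 < h j τ)
    (hrec : ∀ m : ℕ, 1 ≤ m → ∀ τ > (0:ℝ), ∀ x : ℝ,
      x * P m τ x = P (m + 1) τ x + A m τ * P m τ x + B m τ * P (m - 1) τ x) :
    B n t = (n : ℝ) * (n + α) + t * deriv (Hlog α n) t - Hlog α n t := by
  obtain ⟨d, rfl⟩ : ∃ d, n = d + 1 := ⟨n - 1, by omega⟩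
  choose p hp hd hPp using fun m => hmonic m t ht
  have ho : ∀ j k, momentFunctional (todaMoment α t · 1) (p j * p k) =
      if j = k then h j t else 0 := fun j k => by
    rw [← horth j k t ht, ← integral_eval_mul_pertLagWeight hα ht]
    simp only [Polynomial.eval_mul, hPp]
  have hm : ∀ᶠ s in nhds (1 : ℝ), ∀ k,
      HasDerivAt (todaMoment α t k) (-todaMoment α t (k + 1) s) s := by
    filter_upwards [lt_mem_nhds one_pos] with s hs k using hasDerivAt_todaMoment hα ht hs k
  obtain ⟨g, hg, hg'⟩ := hankel_toda hm hp hd ho (fun j => hpos j t ht) d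
  have hpoly : Polynomial.X * p (d + 1) =
      p (d + 2) + A (d + 1) t • p (d + 1) + B (d + 1) t • p d := by
    refine Polynomial.funext fun x => ?_
    simpa [hPp] using hrec (d + 1) hn t ht x
  have hlow : momentFunctional (todaMoment α t · 1) (Polynomial.X * p (d + 1) * p d) =
      B (d + 1) t * h d t := by
    rw [hpoly]
    simp [add_mul, ho]
  have hhigh : momentFunctional (todaMoment α t · 1) (Polynomial.X * p (d + 1) * p d) =
      h (d + 1) t := by
    rw [mul_right_comm, map_mul_orthogonal_of_degree_lt hp hd ho
      (degree_X_mul_lt_of_monic hp hd (by omega)), Polynomial.coeff_X_mul,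
      coeff_self_of_monic hp hd, one_mul]
  have hB : B (d + 1) t = h (d + 1) t / h d t := by
    rw [eq_div_iff (hpos d t ht).ne', ← hlow, hhigh]
  have := mul_deriv_Hlog_sub_Hlog ht hg hg'
  rw [hB]
  linarith
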